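/- Consider the $L_\infty$ approximation problem ${\rm APP} = \{{\rm APP}_{\infty,d}\}_{d \in \mathbb{N}}$ over the weighted Korobov spaces $H(K_{d,\mathbf{r},\mathbf{g}})$ in the worst case setting, for either information class $\Lambda \in \{\Lambda^{\rm std}, \Lambda^{\rm all}\}$ and either error criterion $\star \in \{{\rm ABS}, {\rm NOR}\}$. Then: (i) for every $s > 0$ and $t > 1$, ${\rm APP}$ is algebraically $(s,t)$-weakly tractable; (ii) for every $s > 0$, ${\rm APP}$ is algebraically $(s,1)$-weakly tractable if and only if it is algebraically weakly tractable, if and only if $\lim_{j \to \infty} g_j = 0$. -/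

import Mathlib

open Filter
open scoped ENNReal NNReal

noncomputable section

/-- Coefficient space: `ℓ²` sequences indexed by `ℤ^d`.  An element `u` represents the
function `f ∈ H^ω(𝕋^d)` with Fourier coefficients `f̂(k) = u k / ω k`, so that
`‖u‖_{ℓ²} = ‖f‖_{H^ω}`. -/
abbrev Coef (d : ℕ) := lp (fun _ : Fin d → ℤ => ℂ) 2

/-- The periodic function represented by the coefficients `u`:
`f(x) = ∑_{k ∈ ℤ^d} (u k / ω k) e^{2πi k·x}`. -/
def torusFn {d : ℕ} (ω : (Fin d → ℤ) → ℝ) (u : Coef d) (x : Fin d → ℝ) : ℂ :=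
  ∑' k : Fin d → ℤ,
    ((ω k : ℂ))⁻¹ * u k * Complex.exp (2 * Real.pi * Complex.I * ∑ j, (k j : ℂ) * (x j : ℂ))

/-- The torus `𝕋^d`, modelled as the cube `[0,1]^d`. -/
def cube (d : ℕ) : Set (Fin d → ℝ) := {x | ∀ j, x j ∈ Set.Icc (0 : ℝ) 1}

/-- Standard information: point-evaluation functionals `f ↦ f(x)`. -/
def stdInfo {d : ℕ} (ω : (Fin d → ℤ) → ℝ) : Set (Coef d → ℂ) :=
  {L | ∃ x ∈ cube d, L = fun u => torusFn ω u x}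

/-- General linear information: all continuous linear functionals on `H^ω`. -/
def allInfo (d : ℕ) : Set (Coef d → ℂ) := {L | ∃ T : Coef d →L[ℂ] ℂ, L = ⇑T}

/-- The `n`-th minimal worst case error `e(n, APP_{∞,d}; Λ)` of `L_∞`-approximation on the
unit ball of `H^ω(𝕋^d)`, using algorithms `f ↦ φ(L₁ f, …, Lₙ f)` with `Lᵢ ∈ Λ`. -/
def wcErr {d : ℕ} (ω : (Fin d → ℤ) → ℝ) (Λ : Set (Coef d → ℂ)) (n : ℕ) : ℝ≥0∞ :=
  ⨅ (L : Fin n → Coef d → ℂ) (_ : ∀ i, L i ∈ Λ) (φ : (Fin n → ℂ) → (Fin d → ℝ) → ℂ),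
    ⨆ (u : Coef d) (_ : ‖u‖ ≤ 1) (x : Fin d → ℝ) (_ : x ∈ cube d),
      (‖torusFn ω u x - φ (fun i => L i u) x‖₊ : ℝ≥0∞)

/-- The initial error `e(0, APP_{∞,d}) = sup_{‖f‖_{H^ω} ≤ 1} ‖f‖_∞`. -/
def initErr {d : ℕ} (ω : (Fin d → ℤ) → ℝ) : ℝ≥0∞ :=
  ⨆ (u : Coef d) (_ : ‖u‖ ≤ 1) (x : Fin d → ℝ) (_ : x ∈ cube d),
    (‖torusFn ω u x‖₊ : ℝ≥0∞)

/-- The error criterion: absolute (ABS) or normalized (NOR). -/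
inductive Crit | ABS | NOR

/-- `CRI_d`: the normalizing quantity of the error criterion. -/
def CRI {d : ℕ} (ω : (Fin d → ℤ) → ℝ) : Crit → ℝ≥0∞
  | Crit.ABS => 1
  | Crit.NOR => initErr ω

/-- The information complexity `n^⋆(ε, d; Λ)`. -/
def infoComp {d : ℕ} (ω : (Fin d → ℤ) → ℝ) (Λ : Set (Coef d → ℂ)) (crit : Crit) (ε : ℝ) : ℕ :=
  sInf {n : ℕ | wcErr ω Λ n ≤ ENNReal.ofReal ε * CRI ω crit}

/-- Algebraic strong polynomial tractability of the family of information complexities `nc`. -/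
def ALGSPT (nc : ℕ → ℝ → ℕ) : Prop :=
  ∃ C > (0:ℝ), ∃ p ≥ (0:ℝ), ∀ d : ℕ, 0 < d → ∀ ε ∈ Set.Ioo (0:ℝ) 1,
    (nc d ε : ℝ) ≤ C * ε ^ (-p)

/-- The exponent of algebraic strong polynomial tractability. -/
def ALGSPTexp (nc : ℕ → ℝ → ℕ) : ℝ :=
  sInf {p : ℝ | 0 ≤ p ∧ ∃ C > (0:ℝ), ∀ d : ℕ, 0 < d → ∀ ε ∈ Set.Ioo (0:ℝ) 1,
    (nc d ε : ℝ) ≤ C * ε ^ (-p)}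

/-- Algebraic polynomial tractability. -/
def ALGPT (nc : ℕ → ℝ → ℕ) : Prop :=
  ∃ C > (0:ℝ), ∃ p ≥ (0:ℝ), ∃ q ≥ (0:ℝ), ∀ d : ℕ, 0 < d → ∀ ε ∈ Set.Ioo (0:ℝ) 1,
    (nc d ε : ℝ) ≤ C * (d : ℝ) ^ q * ε ^ (-p)

/-- Algebraic quasi-polynomial tractability. -/
def ALGQPT (nc : ℕ → ℝ → ℕ) : Prop :=
  ∃ C > (0:ℝ), ∃ t ≥ (0:ℝ), ∀ d : ℕ, 0 < d → ∀ ε ∈ Set.Ioo (0:ℝ) 1,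
    (nc d ε : ℝ) ≤ C * Real.exp (t * (1 + Real.log d) * (1 + Real.log ε⁻¹))

/-- The exponent of algebraic quasi-polynomial tractability. -/
def ALGQPTexp (nc : ℕ → ℝ → ℕ) : ℝ :=
  sInf {t : ℝ | 0 ≤ t ∧ ∃ C > (0:ℝ), ∀ d : ℕ, 0 < d → ∀ ε ∈ Set.Ioo (0:ℝ) 1,
    (nc d ε : ℝ) ≤ C * Real.exp (t * (1 + Real.log d) * (1 + Real.log ε⁻¹))}

/-- Exponential quasi-polynomial tractability. -/
def EXPQPT (nc : ℕ → ℝ → ℕ) : Prop :=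
  ∃ C > (0:ℝ), ∃ t ≥ (0:ℝ), ∀ d : ℕ, 0 < d → ∀ ε ∈ Set.Ioo (0:ℝ) 1,
    (nc d ε : ℝ) ≤ C * Real.exp (t * (1 + Real.log d) * (1 + Real.log (Real.log ε⁻¹ + 1)))

/-- The exponent of exponential quasi-polynomial tractability. -/
def EXPQPTexp (nc : ℕ → ℝ → ℕ) : ℝ :=
  sInf {t : ℝ | 0 ≤ t ∧ ∃ C > (0:ℝ), ∀ d : ℕ, 0 < d → ∀ ε ∈ Set.Ioo (0:ℝ) 1,
    (nc d ε : ℝ) ≤ C * Real.exp (t * (1 + Real.log d) * (1 + Real.log (Real.log ε⁻¹ + 1)))}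

/-- `lim_{ε⁻¹ + d → ∞} (log nc(d, ε)) / den(d, ε) = 0`. -/
def WTlim (den : ℕ → ℝ → ℝ) (nc : ℕ → ℝ → ℕ) : Prop :=
  ∀ δ > (0:ℝ), ∃ M : ℝ, ∀ d : ℕ, 0 < d → ∀ ε ∈ Set.Ioo (0:ℝ) 1,
    M ≤ ε⁻¹ + d → |Real.log (nc d ε) / den d ε| < δ

/-- Algebraic `(s,t)`-weak tractability; `ALGWTst 1 1` is algebraic weak tractability. -/
def ALGWTst (s t : ℝ) (nc : ℕ → ℝ → ℕ) : Prop :=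
  WTlim (fun d ε => ε ^ (-s) + (d : ℝ) ^ t) nc

/-- Algebraic uniform weak tractability. -/
def ALGUWT (nc : ℕ → ℝ → ℕ) : Prop := ∀ α > (0:ℝ), ∀ β > (0:ℝ), ALGWTst α β nc

/-- Exponential `(s,t)`-weak tractability; `EXPWTst 1 1` is exponential weak tractability. -/
def EXPWTst (s t : ℝ) (nc : ℕ → ℝ → ℕ) : Prop :=
  WTlim (fun d ε => (1 + Real.log ε⁻¹) ^ s + (d : ℝ) ^ t) nc

/-- Exponential uniform weak tractability. -/
def EXPUWT (nc : ℕ → ℝ → ℕ) : Prop := ∀ α > (0:ℝ), ∀ β > (0:ℝ), EXPWTst α β nc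

/-- `ln₊ x = max(1, ln x)`. -/
def lnplus (x : ℝ) : ℝ := max 1 (Real.log x)

/-- The weight `ω` of the weighted Korobov space `H(K_{d,r,g})`, i.e.
`ω(h) = √(ρ_{d,r,g}(h))` with `ρ_{d,r,g}(h) = ∏_j τ_j(h_j)`, `τ_j(0) = 1` and
`τ_j(h) = g_j⁻¹ |h|^{2 r_j}` for `h ≠ 0` (coordinate `j` uses `g_{j+1}, r_{j+1}`,
the sequences being indexed starting from `1`). -/
def korWeight (g r : ℕ → ℝ) (d : ℕ) (h : Fin d → ℤ) : ℝ :=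
  Real.sqrt (∏ j : Fin d,
    if h j = 0 then 1 else (g (j.1 + 1))⁻¹ * (|h j| : ℝ) ^ (2 * r (j.1 + 1)))

/-- The information complexity function of `L_∞`-approximation over the weighted Korobov
spaces, for the class `Λ^std` (`useStd = true`) or `Λ^all` (`useStd = false`). -/
def korNC (g r : ℕ → ℝ) (useStd : Bool) (crit : Crit) : ℕ → ℝ → ℕ := fun d ε =>
  infoComp (korWeight g r d) (if useStd then stdInfo (korWeight g r d) else allInfo d) crit ε


section Kor
open MeasureTheory UnitAddTorus

local instance instMSUAC : MeasureSpace UnitAddCircle := ⟨AddCircle.haarAddCircle⟩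

local instance instHaarUAC : Measure.IsAddHaarMeasure (volume : Measure UnitAddCircle) :=
  inferInstanceAs (Measure.IsAddHaarMeasure AddCircle.haarAddCircle)

local instance instProbUAC : IsProbabilityMeasure (volume : Measure UnitAddCircle) :=
  inferInstanceAs (IsProbabilityMeasure AddCircle.haarAddCircle)

/-- exponential -/
def ee {d : ℕ} (h : Fin d → ℤ) (x : Fin d → ℝ) : ℂ :=
  Complex.exp (2 * Real.pi * Complex.I * ∑ j, (h j : ℂ) * (x j : ℂ))

def toT {d : ℕ} (x : Fin d → ℝ) : UnitAddTorus (Fin d) := fun j => ((x j : ℝ) : UnitAddCircle)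

lemma ee_eq {d : ℕ} (h : Fin d → ℤ) (x : Fin d → ℝ) : ee h x = mFourier h (toT x) := by
  simp only [ee, mFourier, ContinuousMap.coe_mk, toT]
  rw [Finset.mul_sum, Complex.exp_sum]
  refine Finset.prod_congr rfl fun j _ => ?_
  rw [fourier_coe_apply]
  congr 1
  push_cast
  ring

lemma norm_ee {d : ℕ} (h : Fin d → ℤ) (x : Fin d → ℝ) : ‖ee h x‖ = 1 := by
  rw [ee, show (2 * (Real.pi:ℂ) * Complex.I * ∑ j, (h j : ℂ) * (x j : ℂ))
    = ((2 * Real.pi * ∑ j, (h j : ℝ) * (x j : ℝ) : ℝ) : ℂ) * Complex.I by push_cast; ring]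
  exact Complex.norm_exp_ofReal_mul_I _

lemma ee_add {d : ℕ} (h k : Fin d → ℤ) (x : Fin d → ℝ) : ee (h + k) x = ee h x * ee k x := by
  simp only [ee_eq, mFourier_add]

lemma ee_neg {d : ℕ} (h : Fin d → ℤ) (x : Fin d → ℝ) :
    ee (-h) x = (starRingEnd ℂ) (ee h x) := by
  simp only [ee_eq, mFourier_neg]

lemma ee_zero {d : ℕ} (x : Fin d → ℝ) : ee (0 : Fin d → ℤ) x = 1 := by
  simp [ee]

lemma ee_neg_mul {d : ℕ} (h : Fin d → ℤ) (x : Fin d → ℝ) : ee (-h) x * ee h x = 1 := by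
  rw [← ee_add, neg_add_cancel, ee_zero]

lemma exists_cube {d : ℕ} (y : UnitAddTorus (Fin d)) : ∃ x ∈ cube d, toT x = y := by
  refine ⟨fun j => (AddCircle.equivIco 1 0 (y j)).1, fun j => ?_, ?_⟩
  · have := (AddCircle.equivIco (1:ℝ) 0 (y j)).2
    simp only [zero_add, Set.mem_Ico] at this
    exact ⟨this.1, this.2.le⟩
  · funext j
    exact (AddCircle.equivIco (1:ℝ) 0).symm_apply_apply (y j)

lemma integral_mFourier {d : ℕ} (h : Fin d → ℤ) (hh : h ≠ 0) :
    ∫ y : UnitAddTorus (Fin d), mFourier h y = 0 := by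
  have := (orthonormal_iff_ite.mp (orthonormal_mFourier (d := Fin d))) 0 h
  rw [if_neg (Ne.symm hh)] at this
  rw [← this, ContinuousMap.inner_toLp]
  simp [mFourier_zero]

/-- the continuous function with absolutely summable coefficients -/
lemma hasSumC {d : ℕ} {ι : Type*} (c : ι → ℂ) (k : ι → Fin d → ℤ) (hc : Summable fun i => ‖c i‖) :
    Summable (fun i => c i • (mFourier (k i) : C(UnitAddTorus (Fin d), ℂ))) := by
  refine Summable.of_norm ?_
  simpa only [norm_smul, mFourier_norm, mul_one] using hc

def FC {d : ℕ} {ι : Type*} (c : ι → ℂ) (k : ι → Fin d → ℤ) : C(UnitAddTorus (Fin d), ℂ) :=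
  ∑' i, c i • mFourier (k i)

lemma FC_apply {d : ℕ} {ι : Type*} (c : ι → ℂ) (k : ι → Fin d → ℤ) (hc : Summable fun i => ‖c i‖)
    (y : UnitAddTorus (Fin d)) : FC c k y = ∑' i, c i * mFourier (k i) y := by
  have := (ContinuousMap.evalCLM ℂ y).hasSum (hasSumC c k hc).hasSum
  exact this.tsum_eq.symm

lemma integrableC {d : ℕ} (F : C(UnitAddTorus (Fin d), ℂ)) : Integrable (fun y => F y) :=
  F.continuous.integrable_of_hasCompactSupport (HasCompactSupport.of_compactSpace _)

lemma integral_FC {d : ℕ} {ι : Type*} [Countable ι] (c : ι → ℂ) (k : ι → Fin d → ℤ)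
    (hc : Summable fun i => ‖c i‖) (hk : ∀ i, c i ≠ 0 → k i ≠ 0) : ∫ y, FC c k y = 0 := by
  simp_rw [FC_apply c k hc]
  have hint : ∀ i, Integrable (fun y => c i * mFourier (k i) y) := fun i =>
    (integrableC (mFourier (k i))).const_mul (c i)
  rw [← integral_tsum_of_summable_integral_norm hint]
  · rw [← tsum_zero (β := ι)]
    refine tsum_congr fun i => ?_
    rw [integral_const_mul]
    by_cases h0 : c i = 0
    · simp [h0]
    · rw [integral_mFourier _ (hk i h0), mul_zero]
  · refine hc.congr fun i => ?_
    have : ∀ y, ‖(mFourier (k i)) y‖ = 1 := by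
      intro y
      obtain ⟨x, _, rfl⟩ := exists_cube y
      rw [← ee_eq, norm_ee]
    simp [this]

lemma parseval {d : ℕ} (w : Coef d) (hc : Summable fun i => ‖w i‖) :
    ∫ y, ‖FC (fun i => w i) (fun i => i) y‖ ^ 2 = ‖w‖ ^ 2 := by
  have h1 := (ContinuousMap.toLp (E := ℂ) 2 (volume : Measure (UnitAddTorus (Fin d))) ℂ).hasSum
    (hasSumC (fun i => w i) (fun i => i) hc).hasSum
  have h2 := (mFourierBasis (d := Fin d)).hasSum_repr_symm w
  simp only [coe_mFourierBasis] at h2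
  have h3 := h1.unique (by simpa using h2)
  have h4 : ‖ContinuousMap.toLp (E := ℂ) 2 (volume : Measure (UnitAddTorus (Fin d))) ℂ (FC (fun i => w i) (fun i => i))‖ = ‖w‖ := by
    rw [FC, h3, LinearIsometryEquiv.norm_map]
  rw [← h4, ← inner_self_eq_norm_sq (𝕜 := ℂ), ContinuousMap.inner_toLp, ← integral_re]
  · refine integral_congr_ae (Filter.Eventually.of_forall fun y => ?_)
    simp [Complex.mul_conj, Complex.normSq_eq_norm_sq, -map_pow]
    norm_cast
  · refine Continuous.integrable_of_hasCompactSupport ?_ (HasCompactSupport.of_compactSpace _)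
    fun_prop

/-- weight conditions -/
structure GoodW {d : ℕ} (ω : (Fin d → ℤ) → ℝ) : Prop where
  one_le : ∀ h, 1 ≤ ω h
  summ : Summable fun h => (ω h)⁻¹ ^ 2

lemma GoodW.pos {d : ℕ} {ω : (Fin d → ℤ) → ℝ} (hω : GoodW ω) (h) : 0 < ω h :=
  lt_of_lt_of_le one_pos (hω.one_le h)

lemma coef_norm_sq {d : ℕ} (u : Coef d) : HasSum (fun h => ‖u h‖ ^ 2) (‖u‖ ^ 2) := by
  have := lp.hasSum_norm (p := 2) (by norm_num) u
  simpa using this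

def mkc {d : ℕ} (a : (Fin d → ℤ) → ℂ) (ha : Summable fun h => ‖a h‖ ^ 2) : Coef d :=
  ⟨a, memℓp_gen (by simpa using ha)⟩

@[simp] lemma mkc_apply {d : ℕ} (a : (Fin d → ℤ) → ℂ) (ha : Summable fun h => ‖a h‖ ^ 2) (h) :
    mkc a ha h = a h := rfl

lemma mkc_norm {d : ℕ} (a : (Fin d → ℤ) → ℂ) (ha : Summable fun h => ‖a h‖ ^ 2) :
    ‖mkc a ha‖ ^ 2 = ∑' h, ‖a h‖ ^ 2 := (coef_norm_sq (mkc a ha)).tsum_eq.symm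

lemma feat_summ {d : ℕ} {ω : (Fin d → ℤ) → ℝ} (hω : GoodW ω) {a : (Fin d → ℤ) → ℂ}
    (ha : ∀ h, ‖a h‖ ≤ (ω h)⁻¹) : Summable fun h => ‖a h‖ ^ 2 :=
  hω.summ.of_nonneg_of_le (fun h => by positivity) fun h => by gcongr; exact ha h

lemma norm_coef {d : ℕ} {ω : (Fin d → ℤ) → ℝ} (hω : GoodW ω) (h) :
    ‖((ω h : ℂ))⁻¹‖ = (ω h)⁻¹ := by
  rw [norm_inv, Complex.norm_real, Real.norm_of_nonneg (hω.pos h).le]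

/-- summability of `ω⁻¹ u` -/
lemma summ_l1 {d : ℕ} {ω : (Fin d → ℤ) → ℝ} (hω : GoodW ω) (u : Coef d) :
    Summable fun h => ‖((ω h : ℂ))⁻¹ * u h‖ := by
  refine Summable.of_nonneg_of_le (fun h => norm_nonneg _) (fun h => ?_)
    (hω.summ.add (coef_norm_sq u).summable)
  rw [norm_mul, norm_coef hω]
  have := hω.pos h
  nlinarith [sq_nonneg ((ω h)⁻¹ - ‖u h‖), sq_nonneg ((ω h)⁻¹), sq_nonneg ‖u h‖]

lemma torusFn_eq {d : ℕ} (ω : (Fin d → ℤ) → ℝ) (u : Coef d) (x : Fin d → ℝ) :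
    torusFn ω u x = ∑' k, ((ω k : ℂ))⁻¹ * u k * ee k x := rfl

/-- kernel feature -/
lemma kx_bound {d : ℕ} {ω : (Fin d → ℤ) → ℝ} (hω : GoodW ω) (x : Fin d → ℝ) (h) :
    ‖((ω h : ℂ))⁻¹ * ee (-h) x‖ ≤ (ω h)⁻¹ := by
  rw [norm_mul, norm_ee, mul_one, norm_coef hω]

def kx {d : ℕ} {ω : (Fin d → ℤ) → ℝ} (hω : GoodW ω) (x : Fin d → ℝ) : Coef d :=
  mkc (fun h => ((ω h : ℂ))⁻¹ * ee (-h) x) (feat_summ hω (kx_bound hω x))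

lemma kx_norm {d : ℕ} {ω : (Fin d → ℤ) → ℝ} (hω : GoodW ω) (x : Fin d → ℝ) :
    ‖kx hω x‖ ^ 2 = ∑' h, (ω h)⁻¹ ^ 2 := by
  rw [kx, mkc_norm]
  refine tsum_congr fun h => ?_
  rw [norm_mul, norm_ee, mul_one, norm_coef hω]

lemma inner_kx {d : ℕ} {ω : (Fin d → ℤ) → ℝ} (hω : GoodW ω) (x : Fin d → ℝ) (u : Coef d) :
    inner ℂ (kx hω x) u = torusFn ω u x := by
  rw [lp.inner_eq_tsum, torusFn_eq]
  refine tsum_congr fun h => ?_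
  simp only [kx, mkc_apply, RCLike.inner_apply, map_mul, map_inv₀, Complex.conj_ofReal,
    ee_neg, Complex.conj_conj]
  ring

lemma vx_bound {d : ℕ} {ω : (Fin d → ℤ) → ℝ} (hω : GoodW ω) (h : Fin d → ℤ) (x : Fin d → ℝ) (l) :
    ‖(if l = h then 0 else ((ω l : ℂ))⁻¹ * ee (h - l) x)‖ ≤ (ω l)⁻¹ := by
  split_ifs
  · have := hω.pos l
    simp [this.le]
  rw [norm_mul, norm_ee, mul_one, norm_coef hω]

def vx {d : ℕ} {ω : (Fin d → ℤ) → ℝ} (hω : GoodW ω) (h : Fin d → ℤ) (x : Fin d → ℝ) : Coef d :=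
  mkc (fun l => if l = h then 0 else ((ω l : ℂ))⁻¹ * ee (h - l) x)
    (feat_summ hω (vx_bound hω h x))

lemma vx_norm {d : ℕ} {ω : (Fin d → ℤ) → ℝ} (hω : GoodW ω) (h : Fin d → ℤ) (x : Fin d → ℝ) :
    ‖vx hω h x‖ ^ 2 ≤ ∑' h, (ω h)⁻¹ ^ 2 := by
  rw [vx, mkc_norm]
  refine Summable.tsum_le_tsum (fun l => ?_) (feat_summ hω (vx_bound hω h x)) hω.summ
  gcongr
  exact vx_bound hω h x l

lemma inner_vx {d : ℕ} {ω : (Fin d → ℤ) → ℝ} (hω : GoodW ω) (h : Fin d → ℤ) (x : Fin d → ℝ)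
    (u : Coef d) :
    inner ℂ (vx hω h x) u
      = ∑' l, (if l = h then 0 else ((ω l : ℂ))⁻¹ * u l) * ee (l - h) x := by
  rw [lp.inner_eq_tsum]
  refine tsum_congr fun l => ?_
  simp only [vx, mkc_apply, RCLike.inner_apply]
  split_ifs
  · simp
  · simp only [map_mul, map_inv₀, Complex.conj_ofReal, ← ee_neg, neg_sub]
    ring

lemma inner_vx' {d : ℕ} {ω : (Fin d → ℤ) → ℝ} (hω : GoodW ω) (h : Fin d → ℤ) (x : Fin d → ℝ)
    (u : Coef d) :
    inner ℂ (vx hω h x) u = torusFn ω u x * ee (-h) x - ((ω h : ℂ))⁻¹ * u h := by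
  rw [inner_vx, torusFn_eq, ← tsum_mul_right]
  have hs : Summable fun k => ((ω k : ℂ))⁻¹ * u k * ee k x * ee (-h) x := by
    refine Summable.of_norm ((summ_l1 hω u).congr fun k => ?_)
    simp only [norm_mul, norm_ee, mul_one]
  rw [hs.tsum_eq_add_tsum_ite h]
  have : ((ω h : ℂ))⁻¹ * u h * ee h x * ee (-h) x = ((ω h : ℂ))⁻¹ * u h := by
    rw [mul_assoc, mul_comm (ee h x), ee_neg_mul, mul_one]
  rw [this, add_sub_cancel_left]
  refine tsum_congr fun l => ?_
  split_ifs
  · simp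
  · rw [sub_eq_add_neg, ee_add]; ring

/-- averaging step -/
lemma exists_pt {d : ℕ} {ω : (Fin d → ℤ) → ℝ} (hω : GoodW ω) (A : Finset (Fin d → ℤ))
    (S : (Fin d → ℤ) → Coef d) :
    ∃ x ∈ cube d, (∑ h ∈ A, inner ℂ (vx hω h x) (S h)).re ≤ 0 := by
  classical
  set c : (Fin d → ℤ) → (Fin d → ℤ) → ℂ := fun h l =>
    if l = h then 0 else ((ω l : ℂ))⁻¹ * S h l with hcdef
  have hc : ∀ h, Summable fun l => ‖c h l‖ := fun h => by
    refine Summable.of_nonneg_of_le (fun _ => norm_nonneg _) (fun l => ?_) (summ_l1 hω (S h))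
    simp only [hcdef]
    split_ifs
    · rw [norm_zero]; exact norm_nonneg _
    · exact le_rfl
  set F : C(UnitAddTorus (Fin d), ℂ) := ∑ h ∈ A, FC (c h) (fun l => l - h) with hF
  have hI : ∫ y, F y = 0 := by
    simp only [hF, ContinuousMap.coe_sum, Finset.sum_apply]
    rw [integral_finsetSum _ (fun h _ => integrableC _)]
    refine Finset.sum_eq_zero fun h _ => integral_FC _ _ (hc h) fun l hl => ?_
    rintro h0
    exact hl (by simp [hcdef, sub_eq_zero.mp h0])
  have hre : ∫ y, (F y).re = 0 := by
    have := integral_re (𝕜 := ℂ) (integrableC F)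
    rw [hI] at this
    simpa using this
  obtain ⟨y, hy⟩ := exists_le_integral (μ := (volume : Measure (UnitAddTorus (Fin d))))
    (f := fun y => (F y).re) (integrableC F).re
  rw [hre] at hy
  obtain ⟨x, hx, rfl⟩ := exists_cube y
  refine ⟨x, hx, ?_⟩
  convert hy using 2
  simp only [hF, ContinuousMap.coe_sum, Finset.sum_apply]
  refine Finset.sum_congr rfl fun h _ => ?_
  rw [FC_apply _ _ (hc h), inner_vx]
  simp only [ee_eq]
  rfl

lemma exists_pts {d : ℕ} {ω : (Fin d → ℤ) → ℝ} (hω : GoodW ω) (A : Finset (Fin d → ℤ)) (n : ℕ) :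
    ∃ X : ℕ → Fin d → ℝ, (∀ i, X i ∈ cube d) ∧
      ∑ h ∈ A, ‖∑ k ∈ Finset.range n, vx hω h (X k)‖ ^ 2
        ≤ n * (A.card * ∑' h, (ω h)⁻¹ ^ 2) := by
  induction n with
  | zero => exact ⟨fun _ _ => 0, fun _ _ => by simp, by simp⟩
  | succ n ih =>
    obtain ⟨X, hX, hb⟩ := ih
    obtain ⟨x, hx, hr⟩ := exists_pt hω A (fun h => ∑ k ∈ Finset.range n, vx hω h (X k))
    refine ⟨fun i => if i < n then X i else x, fun i => ?_, ?_⟩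
    · dsimp only
      split_ifs
      exacts [hX i, hx]
    · have e1 : ∀ h, ∑ k ∈ Finset.range (n+1), vx hω h (if k < n then X k else x)
          = vx hω h x + ∑ k ∈ Finset.range n, vx hω h (X k) := fun h => by
        rw [Finset.sum_range_succ, add_comm]
        congr 1
        · simp
        · exact Finset.sum_congr rfl fun k hk => by rw [if_pos (Finset.mem_range.mp hk)]
      simp only [e1]
      have e2 : ∀ h, ‖vx hω h x + ∑ k ∈ Finset.range n, vx hω h (X k)‖ ^ 2
          = ‖vx hω h x‖ ^ 2 + 2 * (inner ℂ (vx hω h x) (∑ k ∈ Finset.range n, vx hω h (X k))).re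
            + ‖∑ k ∈ Finset.range n, vx hω h (X k)‖ ^ 2 := fun h =>
        norm_add_sq (𝕜 := ℂ) _ _
      simp only [e2]
      rw [Finset.sum_add_distrib, Finset.sum_add_distrib, ← Finset.mul_sum, ← Complex.re_sum]
      have e3 : ∑ h ∈ A, ‖vx hω h x‖ ^ 2 ≤ A.card * ∑' h, (ω h)⁻¹ ^ 2 := by
        rw [← nsmul_eq_mul]
        exact Finset.sum_le_card_nsmul _ _ _ fun h _ => vx_norm hω h x
      push_cast
      nlinarith

lemma tx_bound {d : ℕ} {ω : (Fin d → ℤ) → ℝ} (hω : GoodW ω) (A : Finset (Fin d → ℤ))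
    (x : Fin d → ℝ) (l) :
    ‖(if l ∈ A then 0 else ((ω l : ℂ))⁻¹ * ee (-l) x)‖ ≤ (ω l)⁻¹ := by
  split_ifs
  · have := hω.pos l
    simp [this.le]
  rw [norm_mul, norm_ee, mul_one, norm_coef hω]

def tx {d : ℕ} {ω : (Fin d → ℤ) → ℝ} (hω : GoodW ω) (A : Finset (Fin d → ℤ))
    (x : Fin d → ℝ) : Coef d :=
  mkc (fun l => if l ∈ A then 0 else ((ω l : ℂ))⁻¹ * ee (-l) x)
    (feat_summ hω (tx_bound hω A x))

lemma tx_norm {d : ℕ} {ω : (Fin d → ℤ) → ℝ} (hω : GoodW ω) (A : Finset (Fin d → ℤ))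
    (x : Fin d → ℝ) :
    ‖tx hω A x‖ ^ 2 = ∑' h, if h ∈ A then 0 else (ω h)⁻¹ ^ 2 := by
  rw [tx, mkc_norm]
  refine tsum_congr fun l => ?_
  split_ifs
  · simp
  · rw [norm_mul, norm_ee, mul_one, norm_coef hω]

lemma inner_tx {d : ℕ} {ω : (Fin d → ℤ) → ℝ} (hω : GoodW ω) (A : Finset (Fin d → ℤ))
    (x : Fin d → ℝ) (u : Coef d) :
    inner ℂ (tx hω A x) u = torusFn ω u x - ∑ h ∈ A, ((ω h : ℂ))⁻¹ * u h * ee h x := by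
  have hs : Summable fun k => ((ω k : ℂ))⁻¹ * u k * ee k x := by
    refine Summable.of_norm ((summ_l1 hω u).congr fun k => ?_)
    simp only [norm_mul, norm_ee, mul_one]
  have h2 : ∑ h ∈ A, ((ω h : ℂ))⁻¹ * u h * ee h x
      = ∑' h, if h ∈ A then ((ω h : ℂ))⁻¹ * u h * ee h x else 0 := by
    rw [tsum_eq_sum (s := A)]
    · exact Finset.sum_congr rfl fun h hh => by rw [if_pos hh]
    · intro h hh; rw [if_neg hh]
  have hs2 : Summable fun h => if h ∈ A then ((ω h : ℂ))⁻¹ * u h * ee h x else 0 :=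
    summable_of_ne_finset_zero (s := A) fun h hh => by rw [if_neg hh]
  rw [h2, torusFn_eq, ← hs.tsum_sub hs2, lp.inner_eq_tsum]
  refine tsum_congr fun l => ?_
  simp only [tx, mkc_apply, RCLike.inner_apply]
  split_ifs
  · simp
  · simp only [map_mul, map_inv₀, Complex.conj_ofReal, ← ee_neg, neg_neg]
    ring

lemma wcErr_std_le {d : ℕ} {ω : (Fin d → ℤ) → ℝ} (hω : GoodW ω) (A : Finset (Fin d → ℤ))
    (n : ℕ) (hn : 0 < n) :
    wcErr ω (stdInfo ω) n ≤ ENNReal.ofReal (Real.sqrt (∑' h, if h ∈ A then 0 else (ω h)⁻¹ ^ 2)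
      + Real.sqrt ((A.card : ℝ) ^ 2 * (∑' h, (ω h)⁻¹ ^ 2) / n)) := by
  obtain ⟨X, hX, hb⟩ := exists_pts hω A n
  have hn' : (0:ℝ) < n := by exact_mod_cast hn
  have hnC : (n:ℂ) ≠ 0 := by exact_mod_cast hn.ne'
  refine iInf_le_of_le (fun i u => torusFn ω u (X i)) ?_
  refine iInf_le_of_le (fun i => ⟨X i, hX i, rfl⟩) ?_
  refine iInf_le_of_le (fun y x => ∑ h ∈ A, ((n:ℂ)⁻¹ * ∑ k : Fin n, y k * ee (-h) (X k)) * ee h x) ?_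
  refine iSup_le fun u => iSup_le fun hu => iSup_le fun x => iSup_le fun hx => ?_
  rw [← ENNReal.ofReal_coe_nnreal]
  apply ENNReal.ofReal_le_ofReal
  rw [coe_nnnorm]
  have key : torusFn ω u x
      - ∑ h ∈ A, ((n:ℂ)⁻¹ * ∑ k : Fin n, torusFn ω u (X k) * ee (-h) (X k)) * ee h x
      = inner ℂ (tx hω A x) u
        - ∑ h ∈ A, ((n:ℂ)⁻¹ * inner ℂ (∑ k ∈ Finset.range n, vx hω h (X k)) u) * ee h x := by
    rw [inner_tx, sub_sub, ← Finset.sum_add_distrib]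
    congr 1
    refine Finset.sum_congr rfl fun h _ => ?_
    rw [sum_inner]
    simp only [inner_vx']
    rw [Finset.sum_sub_distrib, Finset.sum_const, Finset.card_range, nsmul_eq_mul,
      Fin.sum_univ_eq_sum_range (fun k => torusFn ω u (X k) * ee (-h) (X k)) n]
    field_simp
    ring
  rw [key]
  refine (norm_sub_le _ _).trans (add_le_add ?_ ?_)
  · refine Real.le_sqrt_of_sq_le ?_
    rw [← tx_norm hω A x]
    gcongr
    refine (norm_inner_le_norm _ _).trans ?_
    exact mul_le_of_le_one_right (norm_nonneg _) hu
  · have h1 : ‖∑ h ∈ A, ((n:ℂ)⁻¹ * inner ℂ (∑ k ∈ Finset.range n, vx hω h (X k)) u) * ee h x‖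
        ≤ ∑ h ∈ A, (n:ℝ)⁻¹ * ‖∑ k ∈ Finset.range n, vx hω h (X k)‖ := by
      refine (norm_sum_le _ _).trans (Finset.sum_le_sum fun h _ => ?_)
      rw [norm_mul, norm_ee, mul_one, norm_mul, norm_inv, Complex.norm_natCast]
      gcongr
      refine (norm_inner_le_norm _ _).trans ?_
      exact mul_le_of_le_one_right (norm_nonneg _) hu
    refine h1.trans (Real.le_sqrt_of_sq_le ?_)
    rw [← Finset.mul_sum, mul_pow]
    have h2 := sq_sum_le_card_mul_sum_sq (s := A)
      (f := fun h => ‖∑ k ∈ Finset.range n, vx hω h (X k)‖)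
    calc (n:ℝ)⁻¹ ^ 2 * (∑ h ∈ A, ‖∑ k ∈ Finset.range n, vx hω h (X k)‖) ^ 2
        ≤ (n:ℝ)⁻¹ ^ 2 * (A.card * (n * (A.card * ∑' h, (ω h)⁻¹ ^ 2))) := by
          gcongr
          exact h2.trans (by gcongr)
      _ = _ := by field_simp

lemma initErr_le {d : ℕ} {ω : (Fin d → ℤ) → ℝ} (hω : GoodW ω) :
    initErr ω ≤ ENNReal.ofReal (Real.sqrt (∑' h, (ω h)⁻¹ ^ 2)) := by
  refine iSup_le fun u => iSup_le fun hu => iSup_le fun x => iSup_le fun hx => ?_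
  rw [← ENNReal.ofReal_coe_nnreal]
  apply ENNReal.ofReal_le_ofReal
  rw [coe_nnnorm, ← inner_kx hω]
  refine Real.le_sqrt_of_sq_le ?_
  rw [← kx_norm hω x]
  gcongr
  refine (norm_inner_le_norm _ _).trans ?_
  exact mul_le_of_le_one_right (norm_nonneg _) hu

lemma one_le_initErr {d : ℕ} {ω : (Fin d → ℤ) → ℝ} (h0 : ω 0 = 1) : 1 ≤ initErr ω := by
  classical
  refine le_iSup_of_le (lp.single 2 0 1) (le_iSup_of_le ?_ (le_iSup_of_le (fun _ => 0)
    (le_iSup_of_le (fun _ => by simp) ?_)))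
  · rw [lp.norm_single (by norm_num)]; simp
  · rw [torusFn_eq, tsum_eq_single 0]
    · simp [h0, ee_zero]
    · intro h hh
      simp [lp.single_apply, hh]

lemma std_sub_all {d : ℕ} {ω : (Fin d → ℤ) → ℝ} (hω : GoodW ω) : stdInfo ω ⊆ allInfo d := by
  rintro L ⟨x, _, rfl⟩
  refine ⟨innerSL ℂ (kx hω x), ?_⟩
  funext u
  simp [inner_kx hω]

lemma wcErr_all_le {d : ℕ} {ω : (Fin d → ℤ) → ℝ} (hω : GoodW ω) (n : ℕ) :
    wcErr ω (allInfo d) n ≤ wcErr ω (stdInfo ω) n := by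
  refine iInf_mono fun L => ?_
  exact le_iInf fun hL => iInf_le_of_le (fun i => std_sub_all hω (hL i)) le_rfl

lemma torus_sq {d : ℕ} {ω : (Fin d → ℤ) → ℝ} (hω : GoodW ω) (v : Coef d) :
    ∃ F : C(UnitAddTorus (Fin d), ℂ), (∀ x, F (toT x) = torusFn ω v x) ∧
      ∫ y, ‖F y‖ ^ 2 ≤ ‖v‖ ^ 2 := by
  have hle : ∀ h, ‖((ω h : ℂ))⁻¹ * v h‖ ≤ ‖v h‖ := fun h => by
    rw [norm_mul, norm_coef hω]
    exact mul_le_of_le_one_left (norm_nonneg _) (inv_le_one_of_one_le₀ (hω.one_le h))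
  have hs : Summable fun h => ‖((ω h : ℂ))⁻¹ * v h‖ ^ 2 :=
    (coef_norm_sq v).summable.of_nonneg_of_le (fun h => by positivity) fun h => by
      gcongr; exact hle h
  have hs1 : Summable fun i => ‖mkc _ hs i‖ := summ_l1 hω v
  refine ⟨FC (fun i => mkc _ hs i) (fun i => i), fun x => ?_, ?_⟩
  · rw [FC_apply _ _ hs1, torusFn_eq]
    simp only [ee_eq, mkc_apply]
  · rw [parseval _ hs1, mkc_norm, ← (coef_norm_sq v).tsum_eq]
    exact Summable.tsum_le_tsum (fun h => by gcongr; exact hle h) hs (coef_norm_sq v).summable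

lemma torusFn_neg {d : ℕ} {ω : (Fin d → ℤ) → ℝ} (hω : GoodW ω) (u : Coef d) (x) :
    torusFn ω (-u) x = - torusFn ω u x := by
  rw [← inner_kx hω, inner_neg_right, inner_kx hω]

lemma lower_aux {d : ℕ} {ω : (Fin d → ℤ) → ℝ} (hω : GoodW ω) (n : ℕ) (B : ℝ) (hB : 0 ≤ B)
    (h : wcErr ω (allInfo d) n < ENNReal.ofReal B) :
    (∑' h, (ω h)⁻¹ ^ 2) ≤ B ^ 2 + n := by
  simp only [wcErr, iInf_lt_iff] at h
  obtain ⟨L, hL, φ, h⟩ := h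
  choose T hT using hL
  have hbd : ∀ u : Coef d, ‖u‖ ≤ 1 → ∀ x ∈ cube d,
      ‖torusFn ω u x - φ (fun i => L i u) x‖ ≤ B := by
    intro u hu x hx
    have h1 : (‖torusFn ω u x - φ (fun i => L i u) x‖₊ : ℝ≥0∞) ≤ ENNReal.ofReal B := by
      refine le_trans ?_ h.le
      exact le_iSup_of_le u (le_iSup_of_le hu (le_iSup_of_le x (le_iSup_of_le hx le_rfl)))
    rw [← ENNReal.ofReal_coe_nnreal, coe_nnnorm] at h1
    exact (ENNReal.ofReal_le_ofReal_iff hB).mp h1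
  set t : Fin n → Coef d := fun i => (InnerProductSpace.toDual ℂ (Coef d)).symm (T i) with ht
  set K : Submodule ℂ (Coef d) := Submodule.span ℂ (Set.range t) with hK
  have : FiniteDimensional ℂ K := FiniteDimensional.span_of_finite ℂ (Set.finite_range t)
  have hfr : Module.finrank ℂ K ≤ n := by
    have := finrank_range_le_card (R := ℂ) t
    rw [Fintype.card_fin] at this
    exact this
  -- elements of `Kᗮ`
  have hperp : ∀ u ∈ Kᗮ, ‖u‖ ≤ 1 → ∀ x ∈ cube d, ‖torusFn ω u x‖ ≤ B := by
    intro u hu hu1 x hx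
    have hz : ∀ i, L i u = 0 := fun i => by
      rw [hT i]
      have : T i u = inner ℂ (t i) u := by
        rw [ht]; simp
      rw [this]
      exact Submodule.inner_right_of_mem_orthogonal (K := K) (Submodule.subset_span (Set.mem_range_self i)) hu
    have hz' : ∀ i, L i (-u) = 0 := fun i => by
      have := hz i
      rw [hT i] at this ⊢
      rw [map_neg, this, neg_zero]
    have a1 := hbd u hu1 x hx
    have a2 := hbd (-u) (by rwa [norm_neg]) x hx
    simp only [hz, hz', torusFn_neg hω] at a1 a2
    have a3 : ‖(2:ℂ) * torusFn ω u x‖ ≤ 2 * B := by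
      have : (2:ℂ) * torusFn ω u x = (torusFn ω u x - φ (fun _ => 0) x)
        - (-torusFn ω u x - φ (fun _ => 0) x) := by ring
      rw [this]
      refine (norm_sub_le _ _).trans ?_
      linarith
    rw [norm_mul] at a3
    norm_num at a3
    exact a3
  let b := stdOrthonormalBasis ℂ K
  have hpt : ∀ x ∈ cube d, (∑' h, (ω h)⁻¹ ^ 2) ≤ B ^ 2 + ∑ i, ‖torusFn ω (b i : Coef d) x‖ ^ 2 := by
    intro x hx
    rw [← kx_norm hω x, Submodule.norm_sq_eq_add_norm_sq_projection (kx hω x) K, add_comm]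
    gcongr
    · rw [Submodule.coe_norm]
      set w : Coef d := (Kᗮ.orthogonalProjectionOnto (kx hω x) : Coef d) with hw
      have hwK : w ∈ Kᗮ := (Kᗮ.orthogonalProjectionOnto (kx hω x)).2
      by_cases h0 : ‖w‖ = 0
      · rw [h0]; exact hB
      have h1 := hperp (((‖w‖⁻¹ : ℝ) : ℂ) • w) (Kᗮ.smul_mem _ hwK)
        (by rw [norm_smul]; simp [h0]) x hx
      rw [← inner_kx hω, inner_smul_right, norm_mul] at h1
      have h2 : inner ℂ (kx hω x) w = ((‖w‖ ^ 2 : ℝ) : ℂ) := by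
        have := Submodule.inner_orthogonalProjectionOnto_eq_of_mem_right (K := Kᗮ) ⟨w, hwK⟩ (kx hω x)
        rw [Submodule.coe_inner] at this
        rw [← this]
        simp only [← hw]
        rw [inner_self_eq_norm_sq_to_K]
        push_cast
        rfl
      rw [h2, Complex.norm_real, Complex.norm_real] at h1
      simp at h1
      field_simp at h1
      exact h1
    · rw [← b.sum_sq_norm_inner_right]
      refine (Finset.sum_le_sum fun i _ => ?_)
      rw [← inner_kx hω, norm_inner_symm,
        Submodule.inner_orthogonalProjectionOnto_eq_of_mem_right]
  choose F hF1 hF2 using fun i => torus_sq hω (b i : Coef d)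
  have hpt2 : ∀ y, (∑' h, (ω h)⁻¹ ^ 2) ≤ B ^ 2 + ∑ i, ‖F i y‖ ^ 2 := by
    intro y
    obtain ⟨x, hx, rfl⟩ := exists_cube y
    simpa only [hF1] using hpt x hx
  have hint : ∀ i, Integrable (fun y => ‖F i y‖ ^ 2) := fun i =>
    Continuous.integrable_of_hasCompactSupport (by fun_prop) (HasCompactSupport.of_compactSpace _)
  have hI := integral_mono (μ := (volume : Measure (UnitAddTorus (Fin d))))
    (integrable_const _) ((integrable_const _).add (integrable_finsetSum _ fun i _ => hint i)) hpt2
  simp only [Pi.add_apply] at hI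
  rw [integral_add (integrable_const _) (integrable_finsetSum _ fun i _ => hint i),
    integral_finsetSum _ (fun i _ => hint i)] at hI
  simp only [integral_const, probReal_univ, one_smul] at hI
  have h5 : ∑ i, ∫ y, ‖F i y‖ ^ 2 ≤ n := by
    calc ∑ i, ∫ y, ‖F i y‖ ^ 2 ≤ ∑ i : Fin (Module.finrank ℂ K), (1:ℝ) := by
          refine Finset.sum_le_sum fun i _ => (hF2 i).trans ?_
          have := b.orthonormal.1 i
          rw [Submodule.coe_norm] at this
          rw [this, one_pow]
      _ ≤ n := by simpa using hfr
  linarith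

lemma log_nat_nonneg (n : ℕ) : 0 ≤ Real.log n := Real.log_natCast_nonneg n

def Lam {d : ℕ} (ω : (Fin d → ℤ) → ℝ) (useStd : Bool) : Set (Coef d → ℂ) :=
  if useStd then stdInfo ω else allInfo d

lemma one_le_CRI {d : ℕ} {ω : (Fin d → ℤ) → ℝ} (h0 : ω 0 = 1) (crit : Crit) : 1 ≤ CRI ω crit := by
  cases crit
  · exact le_rfl
  · exact one_le_initErr h0

lemma CRI_le {d : ℕ} {ω : (Fin d → ℤ) → ℝ} (hω : GoodW ω) (h0 : ω 0 = 1) (crit : Crit) :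
    CRI ω crit ≤ ENNReal.ofReal (Real.sqrt (∑' h, (ω h)⁻¹ ^ 2)) := by
  cases crit
  · exact (one_le_initErr h0).trans (initErr_le hω)
  · exact initErr_le hω

lemma wcErr_Lam {d : ℕ} {ω : (Fin d → ℤ) → ℝ} (hω : GoodW ω) (b : Bool) (n : ℕ) :
    wcErr ω (Lam ω b) n ≤ wcErr ω (stdInfo ω) n ∧ wcErr ω (allInfo d) n ≤ wcErr ω (Lam ω b) n := by
  cases b
  · exact ⟨by simpa [Lam] using wcErr_all_le hω n, by simp [Lam]⟩
  · exact ⟨by simp [Lam], by simpa [Lam] using wcErr_all_le hω n⟩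

lemma info_mem {d : ℕ} {ω : (Fin d → ℤ) → ℝ} (hω : GoodW ω) (h0 : ω 0 = 1) (crit : Crit)
    (b : Bool) (ε : ℝ) (n : ℕ) (hn : wcErr ω (stdInfo ω) n ≤ ENNReal.ofReal ε) :
    n ∈ {n : ℕ | wcErr ω (Lam ω b) n ≤ ENNReal.ofReal ε * CRI ω crit} := by
  refine ((wcErr_Lam hω b n).1.trans hn).trans ?_
  calc ENNReal.ofReal ε = ENNReal.ofReal ε * 1 := (mul_one _).symm
    _ ≤ _ := by gcongr; exact one_le_CRI h0 crit

lemma info_lower {d : ℕ} {ω : (Fin d → ℤ) → ℝ} (hω : GoodW ω) (h0 : ω 0 = 1) (crit : Crit)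
    (b : Bool) (n : ℕ) (hn : wcErr ω (stdInfo ω) n ≤ ENNReal.ofReal (1/2)) :
    (∑' h, (ω h)⁻¹ ^ 2) / 4 ≤ infoComp ω (Lam ω b) crit (1/2) := by
  have hm := Nat.sInf_mem ⟨n, info_mem hω h0 crit b _ n hn⟩
  set m := sInf {n : ℕ | wcErr ω (Lam ω b) n ≤ ENNReal.ofReal (1/2) * CRI ω crit} with hmdef
  have hi : infoComp ω (Lam ω b) crit (1/2) = m := rfl
  rw [hi]
  set Λ := ∑' h, (ω h)⁻¹ ^ 2 with hΛ
  have hpos : 1 ≤ Λ := by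
    have := hω.summ.le_tsum 0 (fun _ _ => by positivity)
    have e : ((ω 0)⁻¹) ^ 2 = 1 := by simp [h0]
    linarith
  have hs : 0 < Real.sqrt Λ := Real.sqrt_pos.mpr (by linarith)
  have h1 : wcErr ω (allInfo d) m < ENNReal.ofReal (3/4 * Real.sqrt Λ) := by
    refine ((wcErr_Lam hω b m).2.trans hm).trans_lt ?_
    refine (mul_le_mul_right (CRI_le hω h0 crit) _).trans_lt ?_
    rw [← ENNReal.ofReal_mul (by norm_num)]
    exact (ENNReal.ofReal_lt_ofReal_iff (by positivity)).mpr (by nlinarith)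
  have h2 := lower_aux hω m _ (by positivity) h1
  rw [mul_pow, Real.sq_sqrt (by linarith)] at h2
  linarith

lemma upper_gen {d : ℕ} {ω : (Fin d → ℤ) → ℝ} (hω : GoodW ω) (τ P ε : ℝ) (hτ0 : 0 < τ) (hτ1 : τ < 1)
    (hsum : Summable fun h => ((ω h)⁻¹ ^ 2) ^ τ) (hP : ∑' h, ((ω h)⁻¹ ^ 2) ^ τ ≤ P) (hP1 : 1 ≤ P)
    (hε : ε ∈ Set.Ioo (0:ℝ) 1) :
    ∃ n : ℕ, wcErr ω (stdInfo ω) n ≤ ENNReal.ofReal ε ∧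
      (n:ℝ) ≤ 2 * (4 * P / ε ^ 2) ^ (3 + 2 * (τ / (1 - τ))) := by
  obtain ⟨hε0, hε1⟩ := hε
  set lam : (Fin d → ℤ) → ℝ := fun h => (ω h)⁻¹ ^ 2 with hlam
  have hlp : ∀ h, 0 < lam h := fun h => by have := hω.pos h; positivity
  have hl1 : ∀ h, lam h ≤ 1 := fun h =>
    pow_le_one₀ (by have := hω.pos h; positivity) (inv_le_one_of_one_le₀ (hω.one_le h))
  set Q : ℝ := 4 * P / ε ^ 2 with hQ
  have hQ1 : 1 ≤ Q := by
    rw [hQ, le_div_iff₀ (by positivity)]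
    nlinarith
  have hQ0 : 0 < Q := by linarith
  have hτ' : 0 < 1 - τ := by linarith
  set κ := τ / (1 - τ) with hκ
  have hκ0 : 0 < κ := by positivity
  set θ : ℝ := Q ^ (-(1 / (1 - τ))) with hθ
  have hθ0 : 0 < θ := Real.rpow_pos_of_pos hQ0 _
  have hθ1 : θ ^ (1 - τ) = Q⁻¹ := by
    rw [hθ, ← Real.rpow_mul hQ0.le, ← Real.rpow_neg_one]
    congr 1
    field_simp
  have hθ2 : θ ^ τ = Q ^ (-κ) := by
    rw [hθ, ← Real.rpow_mul hQ0.le]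
    congr 1
    rw [hκ]; field_simp
  have hfin : {h | θ < lam h}.Finite := by
    have h1 := hsum.tendsto_cofinite_zero
    have h2 : ∀ᶠ h in Filter.cofinite, (lam h) ^ τ < θ ^ τ :=
      h1.eventually (gt_mem_nhds (Real.rpow_pos_of_pos hθ0 τ))
    refine Set.Finite.subset h2 ?_
    intro h hh
    simp only [Set.mem_compl_iff, Set.mem_ofPred_eq, not_lt] at hh ⊢
    exact Real.rpow_le_rpow hθ0.le hh.le hτ0.le
  set A : Finset (Fin d → ℤ) := hfin.toFinset with hA
  have hmem : ∀ h, h ∈ A ↔ θ < lam h := fun h => by simp [hA]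
  have hcard : (A.card : ℝ) ≤ P * Q ^ κ := by
    have h1 : (A.card : ℝ) * θ ^ τ ≤ P := by
      calc (A.card : ℝ) * θ ^ τ = ∑ h ∈ A, θ ^ τ := by rw [Finset.sum_const, nsmul_eq_mul]
        _ ≤ ∑ h ∈ A, lam h ^ τ := Finset.sum_le_sum fun h hh =>
            Real.rpow_le_rpow hθ0.le ((hmem h).mp hh).le hτ0.le
        _ ≤ ∑' h, lam h ^ τ := hsum.sum_le_tsum _ (fun h _ => Real.rpow_nonneg (hlp h).le _)
        _ ≤ P := hP
    rw [hθ2, Real.rpow_neg hQ0.le, ← div_eq_mul_inv, div_le_iff₀ (Real.rpow_pos_of_pos hQ0 _)] at h1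
    exact h1
  have htail : ∑' h, (if h ∈ A then 0 else lam h) ≤ (ε / 2) ^ 2 := by
    have hle : ∀ h, (if h ∈ A then 0 else lam h) ≤ Q⁻¹ * lam h ^ τ := fun h => by
      have hnn : 0 ≤ Q⁻¹ * lam h ^ τ := mul_nonneg (by positivity) (Real.rpow_nonneg (hlp h).le _)
      split_ifs with hh
      · exact hnn
      · rw [hmem, not_lt] at hh
        calc lam h = lam h ^ (1 - τ) * lam h ^ τ := by
              rw [← Real.rpow_add (hlp h)]; simp
          _ ≤ θ ^ (1 - τ) * lam h ^ τ := by
              have := hlp h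
              gcongr
          _ = _ := by rw [hθ1]
    have hs2 := hsum.mul_left Q⁻¹
    have h3 := Summable.tsum_le_tsum hle (hs2.of_nonneg_of_le
      (fun h => by split_ifs; exacts [le_rfl, (hlp h).le]) hle) hs2
    refine h3.trans ?_
    rw [tsum_mul_left]
    calc Q⁻¹ * ∑' h, lam h ^ τ ≤ Q⁻¹ * P := by gcongr
      _ = (ε / 2) ^ 2 := by rw [hQ]; field_simp; norm_num
  have hΛ : ∑' h, lam h ≤ P := by
    refine (Summable.tsum_le_tsum (fun h => ?_) hω.summ hsum).trans hP
    exact Real.self_le_rpow_of_le_one (hlp h).le (hl1 h) hτ1.le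
  set y : ℝ := (A.card : ℝ) ^ 2 * Q with hy
  have hy0 : 0 ≤ y := by positivity
  refine ⟨⌊y⌋₊ + 1, ?_, ?_⟩
  · refine (wcErr_std_le hω A _ (Nat.succ_pos _)).trans (ENNReal.ofReal_le_ofReal ?_)
    have e1 : Real.sqrt (∑' h, if h ∈ A then 0 else (ω h)⁻¹ ^ 2) ≤ ε / 2 := by
      rw [Real.sqrt_le_left (by positivity)]
      exact htail
    have hn : y ≤ ((⌊y⌋₊ + 1 : ℕ) : ℝ) := by
      push_cast; exact (Nat.lt_floor_add_one y).le
    have e2 : Real.sqrt ((A.card : ℝ) ^ 2 * (∑' h, (ω h)⁻¹ ^ 2) / ((⌊y⌋₊ + 1 : ℕ) : ℝ)) ≤ ε / 2 := by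
      rw [Real.sqrt_le_left (by positivity), div_le_iff₀ (by positivity)]
      calc (A.card : ℝ) ^ 2 * (∑' h, (ω h)⁻¹ ^ 2) ≤ (A.card : ℝ) ^ 2 * P := by gcongr
        _ = (ε / 2) ^ 2 * y := by rw [hy, hQ]; field_simp; norm_num
        _ ≤ _ := by gcongr
    linarith
  · have hPQ : P ≤ Q := by
      rw [hQ, le_div_iff₀ (by positivity)]
      have : ε ^ 2 ≤ 1 := pow_le_one₀ hε0.le hε1.le
      nlinarith
    have h1 : (A.card : ℝ) ≤ Q ^ (1 + κ) := by
      rw [Real.rpow_add hQ0, Real.rpow_one]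
      exact hcard.trans (by gcongr)
    have h2 : y ≤ Q ^ (3 + 2 * κ) := by
      calc y ≤ (Q ^ (1 + κ)) ^ 2 * Q := by rw [hy]; gcongr
        _ = Q ^ (3 + 2 * κ) := by
          rw [← Real.rpow_natCast, ← Real.rpow_mul hQ0.le]
          nth_rw 2 [← Real.rpow_one Q]
          rw [← Real.rpow_add hQ0]
          congr 1
          push_cast; ring
    have h3 : (1:ℝ) ≤ Q ^ (3 + 2 * κ) := Real.one_le_rpow hQ1 (by positivity)
    have h4 := Nat.floor_le hy0
    push_cast
    linarith

lemma prodsum {d : ℕ} (f : Fin d → ℤ → ℝ) (hf : ∀ j m, 0 ≤ f j m) (hs : ∀ j, Summable (f j)) :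
    Summable (fun h : Fin d → ℤ => ∏ j, f j (h j)) ∧
      ∑' h : Fin d → ℤ, ∏ j, f j (h j) ≤ ∏ j, ∑' m, f j m := by
  classical
  have hb : ∀ s : Finset (Fin d → ℤ), ∑ h ∈ s, ∏ j, f j (h j) ≤ ∏ j, ∑' m, f j m := by
    intro s
    calc ∑ h ∈ s, ∏ j, f j (h j)
        ≤ ∑ h ∈ Fintype.piFinset (fun j => s.image (fun h => h j)), ∏ j, f j (h j) := by
          refine Finset.sum_le_sum_of_subset_of_nonneg ?_ fun h _ _ =>
            Finset.prod_nonneg fun j _ => hf j _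
          intro h hh
          rw [Fintype.mem_piFinset]
          exact fun j => Finset.mem_image_of_mem _ hh
      _ = ∏ j, ∑ m ∈ s.image (fun h => h j), f j m := (Finset.prod_univ_sum _ _).symm
      _ ≤ _ := Finset.prod_le_prod (fun j _ => Finset.sum_nonneg fun m _ => hf j m)
          fun j _ => (hs j).sum_le_tsum _ fun m _ => hf j m
  have hn : ∀ h : Fin d → ℤ, 0 ≤ ∏ j, f j (h j) := fun h => Finset.prod_nonneg fun j _ => hf j _
  have hS := summable_of_sum_le hn hb
  exact ⟨hS, hS.tsum_le_of_sum_le hb⟩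

lemma g_le_one {g : ℕ → ℝ} (hg1 : g 1 ≤ 1) (hgmono : ∀ j, 1 ≤ j → g (j + 1) ≤ g j) (j : ℕ) :
    g (j + 1) ≤ 1 := by
  induction j with
  | zero => simpa using hg1
  | succ j ih => exact (hgmono (j+1) (by omega)).trans ih

lemma r_ge {r : ℕ → ℝ} (hrmono : ∀ j, 1 ≤ j → r j ≤ r (j + 1)) (j : ℕ) :
    r 1 ≤ r (j + 1) := by
  induction j with
  | zero => simp
  | succ j ih => exact ih.trans (hrmono (j+1) (by omega))

lemma int_abs_ge {m : ℤ} (hm : m ≠ 0) : (1:ℝ) ≤ |(m:ℝ)| := by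
  have := Int.one_le_abs hm
  exact_mod_cast this

structure KH (g r : ℕ → ℝ) : Prop where
  gpos : ∀ j, 0 < g (j + 1)
  gle : ∀ j, g (j + 1) ≤ 1
  rge : ∀ j, r 1 ≤ r (j + 1)
  r1 : 1 / 2 < r 1

/-- one-dimensional factor of `λ` -/
def fac (g r : ℕ → ℝ) (j : ℕ) (m : ℤ) : ℝ :=
  if m = 0 then 1 else g (j + 1) * |(m:ℝ)| ^ (-(2 * r (j + 1)))

lemma fac_pos {g r : ℕ → ℝ} (H : KH g r) (j : ℕ) (m : ℤ) : 0 < fac g r j m := by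
  unfold fac
  split_ifs with h
  · exact one_pos
  · have := int_abs_ge h
    exact mul_pos (H.gpos j) (Real.rpow_pos_of_pos (by linarith) _)

lemma fac_le_one {g r : ℕ → ℝ} (H : KH g r) (j : ℕ) (m : ℤ) : fac g r j m ≤ 1 := by
  unfold fac
  split_ifs with h
  · exact le_rfl
  · have h1 := int_abs_ge h
    have h2 := H.rge j
    have h3 := H.r1
    refine mul_le_one₀ (H.gle j) (by positivity) ?_
    exact Real.rpow_le_one_of_one_le_of_nonpos h1 (by linarith)

lemma kor_inv_sq {g r : ℕ → ℝ} (H : KH g r) (d : ℕ) (h : Fin d → ℤ) :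
    (korWeight g r d h)⁻¹ ^ 2 = ∏ j : Fin d, fac g r j (h j) := by
  have e : ∀ j : Fin d, (if h j = 0 then (1:ℝ) else (g (j.1 + 1))⁻¹ * (|h j| : ℝ) ^ (2 * r (j.1 + 1)))
      = (fac g r j (h j))⁻¹ := fun j => by
    unfold fac
    split_ifs with h0
    · simp
    · rw [mul_inv, Real.rpow_neg (abs_nonneg _), inv_inv]
  unfold korWeight
  simp only [e]
  rw [inv_pow, Real.sq_sqrt, Finset.prod_inv_distrib, inv_inv]
  exact Finset.prod_nonneg fun j _ => (inv_pos.mpr (fac_pos H _ _)).le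

lemma kor_one_le {g r : ℕ → ℝ} (H : KH g r) (d : ℕ) (h : Fin d → ℤ) : 1 ≤ korWeight g r d h := by
  have h1 : (korWeight g r d h)⁻¹ ^ 2 ≤ 1 := by
    rw [kor_inv_sq H]
    exact Finset.prod_le_one (fun j _ => (fac_pos H _ _).le) fun j _ => fac_le_one H _ _
  have h2 : 0 < (korWeight g r d h)⁻¹ ^ 2 := by
    rw [kor_inv_sq H]
    exact Finset.prod_pos fun j _ => fac_pos H _ _
  have h3 : 0 ≤ korWeight g r d h := Real.sqrt_nonneg _
  have h4 : 0 < korWeight g r d h := by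
    rcases h3.lt_or_eq with h | h
    · exact h
    · rw [← h] at h2; simp at h2
  have h5 : (korWeight g r d h)⁻¹ ≤ 1 := by
    by_contra hc
    push Not at hc
    nlinarith
  exact (inv_le_one₀ h4).mp h5

lemma kor_zero (g r : ℕ → ℝ) (d : ℕ) : korWeight g r d 0 = 1 := by
  simp [korWeight]

def Zc (b : ℝ) : ℝ := ∑' m : ℤ, |(m:ℝ)| ^ (-b)

lemma Zc_nonneg (b : ℝ) : 0 ≤ Zc b := tsum_nonneg fun m => by positivity

def PP (g : ℕ → ℝ) (τ b : ℝ) (d : ℕ) : ℝ := ∏ j : Fin d, (1 + g (j + 1) ^ τ * Zc b)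

lemma fac_pow_le {g r : ℕ → ℝ} (H : KH g r) {τ : ℝ} (hτ : 0 < τ) (j : ℕ) (m : ℤ) :
    fac g r j m ^ τ ≤ (if m = 0 then 1 else 0) + g (j + 1) ^ τ * |(m:ℝ)| ^ (-(2 * r 1 * τ)) := by
  unfold fac
  have hg := H.gpos j
  split_ifs with h
  · rw [Real.one_rpow]
    have : 0 ≤ g (j + 1) ^ τ * |(m:ℝ)| ^ (-(2 * r 1 * τ)) := by positivity
    linarith
  · have h1 := int_abs_ge h
    have h2 := H.rge j
    rw [zero_add, Real.mul_rpow hg.le (by positivity), ← Real.rpow_mul (abs_nonneg _)]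
    refine mul_le_mul_of_nonneg_left (Real.rpow_le_rpow_of_exponent_le h1 ?_) (by positivity)
    nlinarith

lemma fac_summ {g r : ℕ → ℝ} {τ : ℝ} (hb : 1 < 2 * r 1 * τ) (j : ℕ) :
    HasSum (fun m : ℤ => (if m = 0 then (1:ℝ) else 0) + g (j + 1) ^ τ * |(m:ℝ)| ^ (-(2 * r 1 * τ)))
      (1 + g (j + 1) ^ τ * Zc (2 * r 1 * τ)) :=
  (hasSum_ite_eq 0 1).add ((Real.summable_abs_int_rpow hb).hasSum.mul_left _)

lemma kor_pow_summ {g r : ℕ → ℝ} (H : KH g r) {τ : ℝ} (hτ : 0 < τ) (hb : 1 < 2 * r 1 * τ) (d : ℕ) :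
    Summable (fun h => ((korWeight g r d h)⁻¹ ^ 2) ^ τ) ∧
      ∑' h, ((korWeight g r d h)⁻¹ ^ 2) ^ τ ≤ PP g τ (2 * r 1 * τ) d := by
  have hs : ∀ j, Summable fun m => fac g r j m ^ τ := fun j =>
    (fac_summ hb j).summable.of_nonneg_of_le (fun m => Real.rpow_nonneg (fac_pos H j m).le _)
      fun m => fac_pow_le H hτ j m
  have := prodsum (d := d) (fun j m => fac g r j m ^ τ)
    (fun j m => Real.rpow_nonneg (fac_pos H j m).le _) (fun j => hs j)
  have e : ∀ h : Fin d → ℤ, ((korWeight g r d h)⁻¹ ^ 2) ^ τ = ∏ j : Fin d, fac g r j (h j) ^ τ := fun h => by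
    rw [kor_inv_sq H]
    exact (Real.finsetProd_rpow Finset.univ (fun j : Fin d => fac g r j (h j)) (fun j _ => (fac_pos H j (h j)).le) τ).symm
  simp only [e]
  refine ⟨this.1, this.2.trans ?_⟩
  refine Finset.prod_le_prod (fun j _ => tsum_nonneg fun m => Real.rpow_nonneg (fac_pos H j m).le _)
    fun j _ => ?_
  rw [← (fac_summ hb j).tsum_eq]
  exact Summable.tsum_le_tsum (fun m => fac_pow_le H hτ j m) (hs j) (fac_summ hb j).summable

lemma kor_good {g r : ℕ → ℝ} (H : KH g r) (d : ℕ) : GoodW (korWeight g r d) := by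
  refine ⟨kor_one_le H d, ?_⟩
  have := (kor_pow_summ H one_pos (by linarith [H.r1]) d).1
  simpa only [Real.rpow_one] using this

lemma PP_one_le {g r : ℕ → ℝ} (H : KH g r) (τ b : ℝ) (d : ℕ) : 1 ≤ PP g τ b d := by
  refine Finset.one_le_prod fun j _ => ?_
  have := Zc_nonneg b
  have := H.gpos j
  have : 0 ≤ g (j + 1) ^ τ * Zc b := by positivity
  linarith

lemma log_PP {g r : ℕ → ℝ} (H : KH g r) (τ b : ℝ) (d : ℕ) :
    Real.log (PP g τ b d) ≤ Zc b * ∑ j ∈ Finset.range d, g (j + 1) ^ τ := by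
  have hpos : ∀ j, 0 ≤ g (j + 1) ^ τ * Zc b := fun j => by
    have := Zc_nonneg b
    have := H.gpos j
    positivity
  unfold PP
  rw [Real.log_prod (fun j _ => by linarith [hpos j]), Finset.mul_sum,
    ← Fin.sum_univ_eq_sum_range (fun j => Zc b * g (j + 1) ^ τ)]
  refine Finset.sum_le_sum fun j _ => ?_
  refine (Real.log_le_sub_one_of_pos (by linarith [hpos j])).trans ?_
  linarith

/-- the main upper bound -/
lemma main_upper {g r : ℕ → ℝ} (H : KH g r) {τ : ℝ} (hτ : 0 < τ) (hτ1 : τ < 1)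
    (hb : 1 < 2 * r 1 * τ) (useStd : Bool) (crit : Crit) :
    ∃ a ≥ (0:ℝ), ∀ d : ℕ, ∀ ε ∈ Set.Ioo (0:ℝ) 1,
      Real.log (korNC g r useStd crit d ε)
        ≤ (a + a * ∑ j ∈ Finset.range d, g (j + 1) ^ τ) + a * Real.log ε⁻¹ := by
  set κ := 3 + 2 * (τ / (1 - τ)) with hκ
  have hτ' : 0 < 1 - τ := by linarith
  have hκ0 : 0 < κ := by positivity
  set Z := Zc (2 * r 1 * τ) with hZ
  have hZ0 : 0 ≤ Z := Zc_nonneg _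
  refine ⟨Real.log 2 + κ * Real.log 4 + κ * Z + 2 * κ, ?_, ?_⟩
  · have := Real.log_nonneg (show (1:ℝ) ≤ 2 by norm_num)
    have := Real.log_nonneg (show (1:ℝ) ≤ 4 by norm_num)
    positivity
  intro d ε hε
  have hG := kor_good H d
  have hP1 := PP_one_le H τ (2 * r 1 * τ) d
  obtain ⟨n, hn1, hn2⟩ := upper_gen hG τ (PP g τ (2 * r 1 * τ) d) ε hτ hτ1
    (kor_pow_summ H hτ hb d).1 (kor_pow_summ H hτ hb d).2 hP1 hε
  have h1 : korNC g r useStd crit d ε ≤ n :=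
    Nat.sInf_le (info_mem hG (kor_zero g r d) crit useStd ε n hn1)
  have hl2 := Real.log_nonneg (show (1:ℝ) ≤ 2 by norm_num)
  have hl4 := Real.log_nonneg (show (1:ℝ) ≤ 4 by norm_num)
  have hS : 0 ≤ ∑ j ∈ Finset.range d, g (j + 1) ^ τ :=
    Finset.sum_nonneg fun j _ => by have := H.gpos j; positivity
  have hE : 0 ≤ Real.log ε⁻¹ := Real.log_nonneg ((one_le_inv₀ hε.1).mpr hε.2.le)
  have hPl := log_PP H τ (2 * r 1 * τ) d
  have hε0 := hε.1
  have h2 : Real.log (korNC g r useStd crit d ε) ≤ Real.log 2 + κ * (Real.log 4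
      + Real.log (PP g τ (2 * r 1 * τ) d) + 2 * Real.log ε⁻¹) := by
    rcases Nat.eq_zero_or_pos (korNC g r useStd crit d ε) with h0 | h0
    · rw [h0]
      have := Real.log_nonneg hP1
      simp only [Nat.cast_zero, Real.log_zero]
      positivity
    · have h3 : Real.log (korNC g r useStd crit d ε)
          ≤ Real.log (2 * (4 * PP g τ (2 * r 1 * τ) d / ε ^ 2) ^ κ) := by
        apply Real.log_le_log (by exact_mod_cast h0)
        exact le_trans (by exact_mod_cast h1) hn2
      refine h3.trans (le_of_eq ?_)
      have hPpos : 0 < PP g τ (2 * r 1 * τ) d := by linarith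
      rw [Real.log_mul (by norm_num) (by positivity), Real.log_rpow (by positivity),
        Real.log_div (by positivity) (by positivity), Real.log_mul (by norm_num) (by positivity),
        Real.log_pow, Real.log_inv]
      push_cast
      ring
  refine h2.trans ?_
  set S := ∑ j ∈ Finset.range d, g (j + 1) ^ τ with hSd
  set E := Real.log ε⁻¹ with hEd
  have h5 : κ * Real.log (PP g τ (2 * r 1 * τ) d) ≤ κ * (Z * S) := by gcongr
  have n1 : 0 ≤ κ * Real.log 4 := by positivity
  have n2 : 0 ≤ κ * Z := by positivity
  nlinarith [mul_nonneg hl2 hS, mul_nonneg n1 hS, mul_nonneg hκ0.le hS, mul_nonneg hl2 hE,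
    mul_nonneg n1 hE, mul_nonneg n2 hE]

lemma log_le_aux (a s δ : ℝ) (ha : 0 ≤ a) (hs : 0 < s) (hδ : 0 < δ) :
    ∃ K : ℝ, ∀ ε ∈ Set.Ioo (0:ℝ) 1, a * Real.log ε⁻¹ ≤ δ * ε ^ (-s) + K := by
  have h := (isLittleO_log_rpow_atTop hs).def (c := δ / (a + 1)) (by positivity)
  obtain ⟨R, hR⟩ := Filter.eventually_atTop.mp h
  refine ⟨a * Real.log (max R 1), fun ε hε => ?_⟩
  have hε0 := hε.1
  have h1 : 1 ≤ ε⁻¹ := (one_le_inv₀ hε.1).mpr hε.2.le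
  have hlm : 0 ≤ Real.log (max R 1) := Real.log_nonneg (le_max_right _ _)
  have hp : ε⁻¹ ^ s = ε ^ (-s) := by rw [Real.inv_rpow hε0.le, Real.rpow_neg hε0.le]
  have hp0 : 0 < ε ^ (-s) := Real.rpow_pos_of_pos hε0 _
  rcases le_total R ε⁻¹ with h2 | h2
  · have h3 := hR _ h2
    rw [Real.norm_of_nonneg (Real.log_nonneg h1), Real.norm_of_nonneg (by positivity), hp] at h3
    have h4 : a * Real.log ε⁻¹ ≤ a * (δ / (a + 1) * ε ^ (-s)) := by gcongr
    have h5 : a * (δ / (a + 1) * ε ^ (-s)) ≤ δ * ε ^ (-s) := by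
      have : a * (δ / (a + 1)) ≤ δ := by
        rw [mul_div_assoc', div_le_iff₀ (by positivity)]
        nlinarith
      nlinarith
    nlinarith [mul_nonneg ha hlm]
  · have h3 : Real.log ε⁻¹ ≤ Real.log (max R 1) :=
      Real.log_le_log (by positivity) (h2.trans (le_max_left _ _))
    have : a * Real.log ε⁻¹ ≤ a * Real.log (max R 1) := by gcongr
    nlinarith [mul_pos hδ hp0]

lemma wt_of_bound {nc : ℕ → ℝ → ℕ} {σ : ℕ → ℝ} {a s t : ℝ} (ha : 0 ≤ a) (hs : 0 < s) (ht : 0 < t)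
    (hσ : ∀ η > (0:ℝ), ∃ K : ℝ, ∀ d : ℕ, 0 < d → σ d ≤ η * (d:ℝ) ^ t + K)
    (hb : ∀ d : ℕ, ∀ ε ∈ Set.Ioo (0:ℝ) 1, Real.log (nc d ε) ≤ σ d + a * Real.log ε⁻¹) :
    ALGWTst s t nc := by
  intro δ hδ
  obtain ⟨K1, hK1⟩ := hσ (δ / 2) (by positivity)
  obtain ⟨K2, hK2⟩ := log_le_aux a s (δ / 2) ha hs (by positivity)
  set D : ℝ := 2 * (|K1 + K2| + 1) / δ with hD
  have hD0 : 0 < D := by positivity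
  refine ⟨D ^ (1 / s) + D ^ (1 / t), fun d hd ε hε hM => ?_⟩
  have hε0 := hε.1
  have hd0 : (0:ℝ) < d := by exact_mod_cast hd
  have hx : 0 < ε ^ (-s) := Real.rpow_pos_of_pos hε0 _
  have hy : 0 < (d:ℝ) ^ t := Real.rpow_pos_of_pos hd0 _
  have hden : D ≤ ε ^ (-s) + (d:ℝ) ^ t := by
    by_contra hc
    push Not at hc
    have h1 : ε⁻¹ < D ^ (1 / s) := by
      have : ε⁻¹ = (ε ^ (-s)) ^ (1 / s) := by
        rw [← Real.rpow_mul hε0.le, ← Real.rpow_neg_one]; congr 1; field_simp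
      rw [this]
      exact Real.rpow_lt_rpow hx.le (by linarith) (by positivity)
    have h2 : (d:ℝ) < D ^ (1 / t) := by
      have : (d:ℝ) = ((d:ℝ) ^ t) ^ (1 / t) := by
        rw [← Real.rpow_mul hd0.le, mul_one_div_cancel ht.ne', Real.rpow_one]
      rw [this]
      exact Real.rpow_lt_rpow hy.le (by linarith) (by positivity)
    linarith
  have h3 := hb d ε hε
  have h4 := hK1 d hd
  have h5 := hK2 ε hε
  have h6 : δ / 2 * D = |K1 + K2| + 1 := by rw [hD]; field_simp
  have h7 := le_abs_self (K1 + K2)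
  have h8 : δ / 2 * D ≤ δ / 2 * (ε ^ (-s) + (d:ℝ) ^ t) := by gcongr
  rw [abs_of_nonneg (div_nonneg (log_nat_nonneg _) (by positivity)), div_lt_iff₀ (by positivity)]
  linarith

lemma sig_bound {S : ℕ → ℝ} {a t : ℝ} (ha : 0 ≤ a) (hSd : ∀ d, S d ≤ d)
    (hev : ∀ η > (0:ℝ), ∀ᶠ d : ℕ in Filter.atTop, S d ≤ η * (d:ℝ) ^ t) :
    ∀ η > (0:ℝ), ∃ K : ℝ, ∀ d : ℕ, 0 < d → a + a * S d ≤ η * (d:ℝ) ^ t + K := by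
  intro η hη
  obtain ⟨N, hN⟩ := Filter.eventually_atTop.mp (hev (η / (a + 1)) (by positivity))
  refine ⟨a + a * N, fun d hd => ?_⟩
  have hp : 0 ≤ (d:ℝ) ^ t := by positivity
  rcases le_total N d with h | h
  · have h1 := mul_le_mul_of_nonneg_left (hN d h) ha
    have h2 : a * (η / (a + 1)) ≤ η := by
      rw [mul_div_assoc', div_le_iff₀ (by positivity)]
      nlinarith
    have h3 : a * (η / (a + 1)) * (d:ℝ) ^ t ≤ η * (d:ℝ) ^ t := by gcongr
    have h4 : 0 ≤ a * (N:ℝ) := by positivity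
    nlinarith
  · have h1 : S d ≤ N := (hSd d).trans (by exact_mod_cast h)
    have h2 := mul_le_mul_of_nonneg_left h1 ha
    have h3 : 0 ≤ η * (d:ℝ) ^ t := by positivity
    linarith

lemma kor_sum_lower {g r : ℕ → ℝ} (H : KH g r) {c : ℝ} (hc : 0 < c) (hcg : ∀ j, c ≤ g (j + 1))
    (d : ℕ) : (1 + 2 * c) ^ d ≤ ∑' h, (korWeight g r d h)⁻¹ ^ 2 := by
  have h1 := (kor_good H d).summ.sum_le_tsum
    (Fintype.piFinset fun _ : Fin d => ({-1, 0, 1} : Finset ℤ)) (fun _ _ => by positivity)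
  refine le_trans ?_ h1
  simp only [kor_inv_sq H]
  rw [← Finset.prod_univ_sum (fun _ : Fin d => ({-1, 0, 1} : Finset ℤ)) (fun j m => fac g r j m)]
  have e : ∀ j : Fin d, ∑ m ∈ ({-1, 0, 1} : Finset ℤ), fac g r j m = 1 + 2 * g (j + 1) := by
    intro j
    rw [Finset.sum_insert (by decide), Finset.sum_insert (by decide), Finset.sum_singleton]
    simp [fac]
    ring
  simp only [e]
  calc (1 + 2 * c) ^ d = ∏ _j : Fin d, (1 + 2 * c) := by simp
    _ ≤ _ := Finset.prod_le_prod (fun _ _ => by positivity) fun j _ => by linarith [hcg j]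

lemma necessity {g r : ℕ → ℝ} (H : KH g r) (hgmono : ∀ j, 1 ≤ j → g (j + 1) ≤ g j)
    {τ : ℝ} (hτ : 0 < τ) (hτ1 : τ < 1)
    (hb : 1 < 2 * r 1 * τ) (useStd : Bool) (crit : Crit) (s : ℝ)
    (hwt : ALGWTst s 1 (korNC g r useStd crit)) : Filter.Tendsto g Filter.atTop (nhds 0) := by
  by_cases hex : ∃ c > 0, ∀ j, c ≤ g (j + 1)
  · exfalso
    obtain ⟨c, hc, hcg⟩ := hex
    have hl : 0 < Real.log (1 + 2 * c) := Real.log_pos (by linarith)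
    set l := Real.log (1 + 2 * c) with hldef
    obtain ⟨M, hM⟩ := hwt (l / 2) (by positivity)
    obtain ⟨d, hd⟩ := exists_nat_gt (max (max M 1)
      ((Real.log 4 + l / 2 * (1/2 : ℝ) ^ (-s)) / (l / 2)))
    have hd1 : M < d := (le_max_left _ _).trans_lt ((le_max_left _ _).trans_lt hd)
    have hd2 : (1:ℝ) < d := (le_max_right _ _).trans_lt ((le_max_left _ _).trans_lt hd)
    have hd3 := (le_max_right _ _).trans_lt hd
    have hd0 : 0 < d := by
      have : (0:ℝ) < d := by linarith
      exact_mod_cast this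
    have hhalf : (1/2 : ℝ) ∈ Set.Ioo (0:ℝ) 1 := ⟨by norm_num, by norm_num⟩
    have h1 := hM d hd0 (1/2) hhalf (by norm_num; linarith)
    have hG := kor_good H d
    obtain ⟨n, hn1, -⟩ := upper_gen hG τ (PP g τ (2 * r 1 * τ) d) (1/2) hτ hτ1
      (kor_pow_summ H hτ hb d).1 (kor_pow_summ H hτ hb d).2 (PP_one_le H τ (2 * r 1 * τ) d) hhalf
    have h2 := info_lower hG (kor_zero g r d) crit useStd n hn1
    have h3 : (1 + 2 * c) ^ d / 4 ≤ (korNC g r useStd crit d (1/2) : ℝ) :=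
      le_trans (by linarith [kor_sum_lower H hc hcg d]) h2
    have h4 : d * l - Real.log 4 ≤ Real.log (korNC g r useStd crit d (1/2)) := by
      rw [hldef, ← Real.log_pow, ← Real.log_div (by positivity) (by norm_num)]
      exact Real.log_le_log (by positivity) h3
    have hden : 0 < (1/2 : ℝ) ^ (-s) + (d:ℝ) ^ (1:ℝ) := by positivity
    have h5 := (le_abs_self _).trans_lt h1
    dsimp only at h5
    rw [div_lt_iff₀ hden, Real.rpow_one] at h5
    rw [div_lt_iff₀ (by positivity)] at hd3
    linarith
  · push Not at hex
    rw [Metric.tendsto_atTop]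
    intro c hc
    obtain ⟨j, hj⟩ := hex c hc
    refine ⟨j + 1, fun n hn => ?_⟩
    have h1 : g n ≤ g (j + 1) := by
      induction n, hn using Nat.le_induction with
      | base => exact le_rfl
      | succ n hn ih => exact (hgmono n (by omega)).trans ih
    have h2 : 0 < g n := by
      obtain ⟨k, rfl⟩ : ∃ k, n = k + 1 := ⟨n - 1, by omega⟩
      exact H.gpos k
    rw [Real.dist_eq, sub_zero, abs_of_pos h2]
    linarith

end Kor

/-- For the weighted Korobov spaces, for either information class and
either error criterion: (i) ALG-`(s,t)`-WT always holds for `s > 0`, `t > 1`;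
(ii) for `s > 0`, ALG-`(s,1)`-WT ⟺ ALG-WT ⟺ `lim_j g_j = 0`. -/
theorem stmt14
    (g r : ℕ → ℝ)
    (hg1 : g 1 ≤ 1) (hgpos : ∀ j, 1 ≤ j → 0 < g j)
    (hgmono : ∀ j, 1 ≤ j → g (j + 1) ≤ g j)
    (hr1 : 1 / 2 < r 1) (hrmono : ∀ j, 1 ≤ j → r j ≤ r (j + 1))
    (crit : Crit) (useStd : Bool) :
    (∀ s > (0:ℝ), ∀ t > (1:ℝ), ALGWTst s t (korNC g r useStd crit)) ∧
    (∀ s > (0:ℝ),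
      (ALGWTst s 1 (korNC g r useStd crit) ↔ ALGWTst 1 1 (korNC g r useStd crit)) ∧
      (ALGWTst 1 1 (korNC g r useStd crit) ↔
        Filter.Tendsto g Filter.atTop (nhds 0))) := by
  have H : KH g r := ⟨fun j => hgpos _ (by omega), g_le_one hg1 hgmono, r_ge hrmono, hr1⟩
  obtain ⟨τ, hτa, hτ1⟩ := exists_between (show 1 / (2 * r 1) < 1 by
    rw [div_lt_one (by linarith)]; linarith)
  have hr0 : 0 < 2 * r 1 := by linarith
  have hτ : 0 < τ := lt_trans (by positivity) hτa
  have hb : 1 < 2 * r 1 * τ := by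
    rw [div_lt_iff₀ hr0] at hτa
    linarith
  obtain ⟨a, ha, hup⟩ := main_upper H hτ hτ1 hb useStd crit
  have hSd : ∀ d : ℕ, ∑ j ∈ Finset.range d, g (j + 1) ^ τ ≤ d := fun d => by
    calc ∑ j ∈ Finset.range d, g (j + 1) ^ τ ≤ ∑ j ∈ Finset.range d, (1:ℝ) :=
          Finset.sum_le_sum fun j _ => Real.rpow_le_one (H.gpos j).le (H.gle j) hτ.le
      _ = d := by simp
  have hsuff : Filter.Tendsto g Filter.atTop (nhds 0) → ∀ s > (0:ℝ),
      ALGWTst s 1 (korNC g r useStd crit) := by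
    intro hg s hs
    refine wt_of_bound ha hs one_pos (sig_bound ha hSd ?_) hup
    intro η hη
    have h1 : Filter.Tendsto (fun j => g (j + 1) ^ τ) Filter.atTop (nhds 0) := by
      have h2 := (hg.comp (Filter.tendsto_add_atTop_nat 1)).rpow_const (p := τ) (Or.inr hτ.le)
      rw [Real.zero_rpow hτ.ne'] at h2
      exact h2
    filter_upwards [h1.cesaro.eventually (gt_mem_nhds hη), Filter.eventually_gt_atTop 0] with d h2 h3
    have h3' : (0:ℝ) < d := by exact_mod_cast h3
    rw [inv_mul_lt_iff₀ h3'] at h2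
    rw [Real.rpow_one]
    linarith
  have hnec := fun s => necessity H hgmono hτ hτ1 hb useStd crit s
  refine ⟨fun s hs t ht => ?_, fun s hs => ⟨⟨fun h => hsuff (hnec s h) 1 one_pos,
    fun h => hsuff (hnec 1 h) s hs⟩, ⟨hnec 1, fun h => hsuff h 1 one_pos⟩⟩⟩
  refine wt_of_bound ha hs (by linarith) (sig_bound ha hSd ?_) hup
  intro η hη
  have h1 := (tendsto_rpow_neg_atTop (show 0 < t - 1 by linarith)).comp
    (tendsto_natCast_atTop_atTop (R := ℝ))
  filter_upwards [h1.eventually (gt_mem_nhds hη), Filter.eventually_gt_atTop 0] with d h2 h3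
  have h3' : (0:ℝ) < d := by exact_mod_cast h3
  refine (hSd d).trans ?_
  have h4 : (d:ℝ) = (d:ℝ) ^ (-(t - 1)) * (d:ℝ) ^ t := by
    rw [← Real.rpow_add h3']; ring_nf; simp
  have h5 : (d:ℝ) ^ (-(t - 1)) * (d:ℝ) ^ t ≤ η * (d:ℝ) ^ t := by
    have h6 : (d:ℝ) ^ (-(t - 1)) < η := h2
    gcongr
  exact h4.le.trans h5
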